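/- Let H := −Σ_{i∈ι} J_i g_i be a stabilizer Hamiltonian (g_i ∈ 𝒫ⁿ pairwise commuting, J_i > 0, ι finite), let 𝒮 := ⟨g_i : i ∈ ι⟩ be the stabilizer group, let β > 0, f̄ ≥ 0 and ω ≥ 0. Suppose: (a) for every S ∈ 𝒮 there is a Pauli path ζ(S) = (𝟙, Q₁, …, Q_L = S) such that ε̄_P(Q_t) ≤ ω for every P ∈ 𝒫ⁿ and every t; (b) {Γ_P}_{P∈𝒫ⁿ} is a family where each Γ_P is a nonempty finite set of Pauli paths, each γ ∈ Γ_P ending at S_γ·P for some S_γ ∈ 𝒮, satisfying ε̄_P(U_e) + β⁻¹·log(|Γ_P^{∩e}|/|Γ_P|) ≤ f̄ for every P, every γ ∈ Γ_P, and every edge e = (U_e, V_e) of γ. For γ ∈ Γ_P ending at S_γ·P, let γ' be the concatenation of γ with the translate of ζ(S_γ) by the endpoint of γ (so γ' ends at S_γ·S_γ·P = P), and let Γ'_P := {γ' : γ ∈ Γ_P}. Assume additionally (c) for every P, no edge of an appended ζ-segment of a path of Γ'_P coincides with an edge of the original γ-segment of a path of Γ'_P. Then {Γ'_P}_{P∈𝒫ⁿ}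 assigns to each P a nonempty finite set of Pauli paths ending at P, and it satisfies ε̄_P(U_e) + β⁻¹·log(|Γ'_P{}^{∩e}|/|Γ'_P|) ≤ f̄ + ω for every P, every γ' ∈ Γ'_P, and every edge e = (U_e, V_e) of γ'. -/

import Mathlib

open Matrix

noncomputable section

/-- Labels for `n`-qubit Pauli operators: `(0,0) ↦ I`, `(1,0) ↦ X`, `(1,1) ↦ Y`, `(0,1) ↦ Z`.
Multiplication of Pauli operators, up to phase, corresponds to addition of labels. -/
abbrev Lab (n : ℕ) := Fin n → ZMod 2 × ZMod 2

/-- The single-qubit Pauli matrices. -/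
def pauli1 : ZMod 2 × ZMod 2 → Matrix (Fin 2) (Fin 2) ℂ := fun p =>
  if p = (0, 0) then 1
  else if p = (1, 0) then !![0, 1; 1, 0]
  else if p = (1, 1) then !![0, -Complex.I; Complex.I, 0]
  else !![1, 0; 0, -1]

/-- The `n`-fold Kronecker product of single-qubit Pauli matrices described by the label `a`. -/
def nPauli {n : ℕ} (a : Lab n) : Matrix (Fin n → Fin 2) (Fin n → Fin 2) ℂ :=
  Matrix.of fun v w => ∏ i, pauli1 (a i) (v i) (w i)

/-- The `ℓ²` operator norm of a matrix. -/
def opNorm {m : Type*} [Fintype m] [DecidableEq m] (A : Matrix m m ℂ) : ℝ :=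
  ‖Matrix.toEuclideanCLM (𝕜 := ℂ) A‖

/-- A Pauli path: a finite sequence `U 0 = 𝟙, U 1, …, U T` of Pauli operators (written as
labels), each step multiplying by a nontrivial single-site Pauli.  (The sequence is recorded
as a function on `ℕ`, constant from `T` onwards.) -/
structure PPath (n : ℕ) where
  T : ℕ
  U : ℕ → Lab n
  start : U 0 = 0
  step : ∀ t, t < T → ∃ a : Lab n,
    (∃ i, a i ≠ 0 ∧ ∀ j, j ≠ i → a j = 0) ∧ U (t + 1) = a + U t
  stable : ∀ t, T ≤ t → U t = U T

/-- The endpoint of a Pauli path. -/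
def PPath.last {n : ℕ} (γ : PPath n) : Lab n := γ.U γ.T

/-- `e` is an edge of `γ`: a pair of consecutive Paulis in the path. -/
def PPath.hasEdge {n : ℕ} (γ : PPath n) (e : Lab n × Lab n) : Prop :=
  ∃ t, t < γ.T ∧ γ.U t = e.1 ∧ γ.U (t + 1) = e.2

/-- Concatenation `(𝟙, P₁, …, P_T, Q₁·P_T, …, Q_L·P_T)` of a path `γ = (𝟙, P₁, …, P_T)`
with the translate of a path `ζ = (𝟙, Q₁, …, Q_L)` by the endpoint of `γ`. -/
def PPath.concat {n : ℕ} (γ ζ : PPath n) : PPath n where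
  T := γ.T + ζ.T
  U := fun t => if t ≤ γ.T then γ.U t else ζ.U (t - γ.T) + γ.U γ.T
  start := by simp [γ.start]
  step := by
    intro t ht
    beta_reduce
    by_cases h1 : t + 1 ≤ γ.T
    · obtain ⟨a, ha, hs⟩ := γ.step t (by omega)
      exact ⟨a, ha, by rw [if_pos h1, if_pos (by omega : t ≤ γ.T)]; exact hs⟩
    · by_cases h2 : t ≤ γ.T
      · obtain ⟨a, ha, hs⟩ := ζ.step 0 (by omega)
        refine ⟨a, ha, ?_⟩
        rw [if_neg h1, if_pos h2, show t = γ.T by omega,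
          show γ.T + 1 - γ.T = 1 by omega, hs, ζ.start]
        abel
      · obtain ⟨a, ha, hs⟩ := ζ.step (t - γ.T) (by omega)
        refine ⟨a, ha, ?_⟩
        rw [if_neg h1, if_neg h2, show t + 1 - γ.T = t - γ.T + 1 by omega, hs]
        abel
  stable := by
    intro t ht
    beta_reduce
    rcases Nat.eq_zero_or_pos ζ.T with h0 | h0
    · rw [if_pos (show γ.T + ζ.T ≤ γ.T by omega)]
      by_cases h : t ≤ γ.T
      · rw [if_pos h, show t = γ.T + ζ.T by omega]
      · rw [if_neg h, ζ.stable (t - γ.T) (by omega), h0, ζ.start]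
        simp
    · rw [if_neg (show ¬(γ.T + ζ.T ≤ γ.T) by omega),
        if_neg (show ¬(t ≤ γ.T) by omega),
        ζ.stable (t - γ.T) (by omega), show γ.T + ζ.T - γ.T = ζ.T by omega]

theorem pauli1_phase (a b : ZMod 2 × ZMod 2) (v x y w : Fin 2) :
    (pauli1 a * pauli1 b) v x * (pauli1 b * pauli1 a) y w
      = pauli1 (a + b) v x * pauli1 (a + b) y w := by
  have h2 : (1 : ZMod 2) + 1 = 0 := by decide
  have key : ∀ c : ZMod 2, c = 0 ∨ c = 1 := by decide
  obtain ⟨a1, a2⟩ := a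
  obtain ⟨b1, b2⟩ := b
  rcases key a1 with rfl | rfl <;> rcases key a2 with rfl | rfl <;>
  rcases key b1 with rfl | rfl <;> rcases key b2 with rfl | rfl <;>
  fin_cases v <;> fin_cases x <;> fin_cases y <;> fin_cases w <;>
  simp [pauli1, h2, Matrix.mul_apply, Fin.sum_univ_two]

theorem pauli1_sq (a : ZMod 2 × ZMod 2) : pauli1 a * pauli1 a = 1 := by
  have key : ∀ c : ZMod 2, c = 0 ∨ c = 1 := by decide
  obtain ⟨a1, a2⟩ := a
  rcases key a1 with rfl | rfl <;> rcases key a2 with rfl | rfl <;>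
  ext v w <;> fin_cases v <;> fin_cases w <;>
  simp [pauli1, Matrix.mul_apply, Fin.sum_univ_two]

theorem nPauli_mul_apply {n : ℕ} (a b : Lab n) (v w : Fin n → Fin 2) :
    (nPauli a * nPauli b) v w = ∏ i, (pauli1 (a i) * pauli1 (b i)) (v i) (w i) := by
  simp only [Matrix.mul_apply, nPauli, Matrix.of_apply]
  rw [Finset.prod_univ_sum]
  simp [Finset.prod_mul_distrib]

theorem nPauli_sq {n : ℕ} (a : Lab n) : nPauli a * nPauli a = 1 := by
  ext v w
  rw [nPauli_mul_apply]
  simp only [pauli1_sq, Matrix.one_apply]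
  by_cases h : v = w
  · subst h; simp
  · rw [if_neg h]
    obtain ⟨i, hi⟩ := Function.ne_iff.mp h
    exact Finset.prod_eq_zero (Finset.mem_univ i) (if_neg hi)

/-- Conjugation by a Pauli operator. -/
def pconj {n : ℕ} (a : Lab n) (M : Matrix (Fin n → Fin 2) (Fin n → Fin 2) ℂ) :
    Matrix (Fin n → Fin 2) (Fin n → Fin 2) ℂ := nPauli a * M * nPauli a

theorem pconj_add {n : ℕ} (a b : Lab n) (M : Matrix (Fin n → Fin 2) (Fin n → Fin 2) ℂ) :
    pconj (a + b) M = pconj a (pconj b M) := by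
  have h : pconj a (pconj b M) = (nPauli a * nPauli b) * M * (nPauli b * nPauli a) := by
    simp only [pconj, Matrix.mul_assoc]
  rw [h, pconj]
  ext v w
  rw [Matrix.mul_apply, Matrix.mul_apply]
  refine Finset.sum_congr rfl fun y _ => ?_
  rw [Matrix.mul_apply, Matrix.mul_apply, Finset.sum_mul, Finset.sum_mul]
  refine Finset.sum_congr rfl fun x _ => ?_
  have e : (nPauli a * nPauli b) v x * (nPauli b * nPauli a) y w
      = nPauli (a + b) v x * nPauli (a + b) y w := by
    rw [nPauli_mul_apply, nPauli_mul_apply, ← Finset.prod_mul_distrib]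
    simp only [pauli1_phase, nPauli, Matrix.of_apply, ← Finset.prod_mul_distrib, Pi.add_apply]
  linear_combination -(M x y) * e

theorem pconj_self {n : ℕ} (a : Lab n) (M : Matrix (Fin n → Fin 2) (Fin n → Fin 2) ℂ) :
    pconj a (pconj a M) = M := by
  simp only [pconj]
  calc _ = (nPauli a * nPauli a) * M * (nPauli a * nPauli a) := by
        simp only [Matrix.mul_assoc]
    _ = M := by rw [nPauli_sq]; simp

theorem lab_add_self {n : ℕ} (a : Lab n) : a + a = 0 := by
  have key : ∀ c : ZMod 2 × ZMod 2, c + c = 0 := by decide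
  funext i
  exact key (a i)

theorem concat_U_left {n : ℕ} (γ ζ : PPath n) {t : ℕ} (h : t ≤ γ.T) :
    (γ.concat ζ).U t = γ.U t := if_pos h

theorem concat_U_right {n : ℕ} (γ ζ : PPath n) (k : ℕ) :
    (γ.concat ζ).U (γ.T + k) = ζ.U k + γ.last := by
  rcases Nat.eq_zero_or_pos k with rfl | hk
  · rw [Nat.add_zero, concat_U_left γ ζ le_rfl, ζ.start, zero_add]; rfl
  · have h : ¬ (γ.T + k ≤ γ.T) := by omega
    show (if γ.T + k ≤ γ.T then _ else _) = _
    rw [if_neg h, Nat.add_sub_cancel_left]; rfl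

theorem concat_T {n : ℕ} (γ ζ : PPath n) : (γ.concat ζ).T = γ.T + ζ.T := rfl

theorem concat_hasEdge {n : ℕ} (γ ζ : PPath n) (e : Lab n × Lab n) :
    (γ.concat ζ).hasEdge e ↔ γ.hasEdge e ∨
      ∃ k < ζ.T, (ζ.U k + γ.last, ζ.U (k + 1) + γ.last) = e := by
  constructor
  · rintro ⟨t, ht, h1, h2⟩
    rw [concat_T] at ht
    by_cases h : t < γ.T
    · left
      rw [concat_U_left _ _ (by omega)] at h1 h2
      exact ⟨t, h, h1, h2⟩
    · right
      obtain ⟨k, rfl⟩ := Nat.exists_eq_add_of_le (not_lt.mp h)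
      rw [concat_U_right] at h1
      rw [Nat.add_assoc, concat_U_right] at h2
      exact ⟨k, by omega, Prod.ext h1 h2⟩
  · rintro (⟨t, ht, h1, h2⟩ | ⟨k, hk, rfl⟩)
    · refine ⟨t, by rw [concat_T]; omega, ?_, ?_⟩
      · rw [concat_U_left _ _ (by omega)]; exact h1
      · rw [concat_U_left _ _ (by omega)]; exact h2
    · exact ⟨γ.T + k, by rw [concat_T]; omega, concat_U_right _ _ _,
        by rw [Nat.add_assoc]; exact concat_U_right _ _ _⟩

theorem ppath_ext {n : ℕ} (γ γ' : PPath n) (hT : γ.T = γ'.T) (hU : ∀ t ≤ γ.T, γ.U t = γ'.U t) :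
    γ = γ' := by
  have hU' : γ.U = γ'.U := by
    funext t
    by_cases h : t ≤ γ.T
    · exact hU t h
    · rw [γ.stable t (by omega), γ'.stable t (by omega), hU _ le_rfl, hT]
  cases γ; cases γ'
  simp only at hT hU'
  subst hT hU'
  rfl

theorem concat_inj_aux {n : ℕ} (γ₁ γ₂ ζ₁ ζ₂ : PPath n)
    (hd : ∀ k < ζ₁.T, ∀ t < γ₂.T,
      (ζ₁.U k + γ₁.last, ζ₁.U (k + 1) + γ₁.last) ≠ (γ₂.U t, γ₂.U (t + 1)))
    (h : γ₁.concat ζ₁ = γ₂.concat ζ₂) : γ₂.T ≤ γ₁.T := by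
  by_contra hlt
  have hT : γ₁.T + ζ₁.T = γ₂.T + ζ₂.T := congrArg PPath.T h
  refine hd 0 (by omega) γ₁.T (by omega) ?_
  rw [← concat_U_right, ← concat_U_right, h, Nat.add_zero, Nat.zero_add,
    concat_U_left _ _ (by omega), concat_U_left _ _ (by omega)]

open scoped Classical in
/-- (Lemma `pauli-flow-degen`.) A flow `{Γ_P}` whose paths end at
stabilizer-equivalent representatives `S_γ·P`, with free energy at most `f̄`, upgrades — by
appending translates of low-barrier paths `ζ(S_γ)` building the stabilizer elements, and
assuming the appended segments share no edge with the original segments — to a genuine Pauli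
flow `{Γ'_P}` (paths ending at `P`) of free energy at most `f̄ + ω`. -/
theorem stmt_17 {n : ℕ} (hn : 1 ≤ n) {ι : Type*} [Fintype ι]
    (G : ι → Lab n)
    (hcomm : ∀ i j, Commute (nPauli (G i)) (nPauli (G j)))
    (J : ι → ℝ) (hJ : ∀ i, 0 < J i)
    (H : Matrix (Fin n → Fin 2) (Fin n → Fin 2) ℂ)
    (hH : H = -∑ i, (J i : ℂ) • nPauli (G i))
    (Ebar : Lab n → Lab n → ℝ)
    (hEbar : ∀ pl ul, Ebar pl ul
      = opNorm (nPauli pl * nPauli ul * H * nPauli ul * nPauli pl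
          + nPauli ul * H * nPauli ul - nPauli pl * H * nPauli pl - H))
    (β fbar w : ℝ) (hβ : 0 < β) (hfbar : 0 ≤ fbar) (hw : 0 ≤ w)
    (𝒮 : AddSubgroup (Lab n)) (h𝒮 : 𝒮 = AddSubgroup.closure (Set.range G))
    (ζ : Lab n → PPath n)
    (hζend : ∀ s ∈ 𝒮, (ζ s).last = s)
    (hζbar : ∀ s ∈ 𝒮, ∀ t ≤ (ζ s).T, ∀ pl : Lab n, Ebar pl ((ζ s).U t) ≤ w)
    (Γ : Lab n → Finset (PPath n))
    (hΓne : ∀ pl, (Γ pl).Nonempty)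
    (hΓend : ∀ pl, ∀ γ ∈ Γ pl, ∃ s ∈ 𝒮, γ.last = s + pl)
    (hfree : ∀ pl, ∀ γ ∈ Γ pl, ∀ t, t < γ.T →
      Ebar pl (γ.U t) + β⁻¹ * Real.log
          ((((Γ pl).filter (fun γ' => γ'.hasEdge (γ.U t, γ.U (t + 1)))).card : ℝ)
            / ((Γ pl).card : ℝ)) ≤ fbar)
    (hdisjoint : ∀ pl, ∀ γ₁ ∈ Γ pl, ∀ γ₂ ∈ Γ pl,
      ∀ k < (ζ (γ₁.last + pl)).T, ∀ t < γ₂.T,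
        ((ζ (γ₁.last + pl)).U k + γ₁.last, (ζ (γ₁.last + pl)).U (k + 1) + γ₁.last)
          ≠ (γ₂.U t, γ₂.U (t + 1)))
    (Γ' : Lab n → Finset (PPath n))
    (hΓ' : ∀ pl, Γ' pl = (Γ pl).image (fun γ => γ.concat (ζ (γ.last + pl)))) :
    (∀ pl, (Γ' pl).Nonempty ∧ ∀ γ' ∈ Γ' pl, γ'.last = pl) ∧
    (∀ pl, ∀ γ' ∈ Γ' pl, ∀ t, t < γ'.T →
      Ebar pl (γ'.U t) + β⁻¹ * Real.log
          ((((Γ' pl).filter (fun γ'' => γ''.hasEdge (γ'.U t, γ'.U (t + 1)))).card : ℝ)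
            / ((Γ' pl).card : ℝ)) ≤ fbar + w) := by
  have inj : ∀ pl, Set.InjOn (fun γ : PPath n => γ.concat (ζ (γ.last + pl))) (Γ pl) := by
    intro pl γ₁ h₁ γ₂ h₂ h
    have hT : γ₁.T = γ₂.T := le_antisymm
      (concat_inj_aux _ _ _ _ (hdisjoint pl γ₂ h₂ γ₁ h₁) h.symm)
      (concat_inj_aux _ _ _ _ (hdisjoint pl γ₁ h₁ γ₂ h₂) h)
    refine ppath_ext _ _ hT fun t ht => ?_
    have := congrArg (fun p => PPath.U p t) h
    simp only at this
    rwa [concat_U_left _ _ ht, concat_U_left _ _ (hT ▸ ht)] at this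
  have hmem : ∀ pl, ∀ γ ∈ Γ pl, γ.last + pl ∈ 𝒮 := by
    intro pl γ hγ
    obtain ⟨s, hs, he⟩ := hΓend pl γ hγ
    rwa [he, add_assoc, lab_add_self, add_zero]
  have hfix : ∀ s ∈ 𝒮, pconj s H = H := by
    intro s hs
    rw [h𝒮] at hs
    induction hs using AddSubgroup.closure_induction with
    | mem x hx =>
      obtain ⟨i, rfl⟩ := hx
      have hc : Commute (nPauli (G i)) H := by
        rw [hH]
        exact (Commute.sum_right _ _ _ fun j _ => (hcomm i j).smul_right _).neg_right
      rw [pconj, hc.eq, Matrix.mul_assoc, nPauli_sq, Matrix.mul_one]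
    | zero =>
      have := pconj_add (0 : Lab n) 0 H
      rw [pconj_self, add_zero] at this
      exact this
    | add x y _ _ hx hy => rw [pconj_add, hy, hx]
    | neg x _ hx =>
      have : -x = x := neg_eq_of_add_eq_zero_left (lab_add_self x)
      rw [this, hx]
  have hE : ∀ pl ul, Ebar pl ul
      = opNorm (pconj pl (pconj ul H) + pconj ul H - pconj pl H - H) := by
    intro pl ul
    rw [hEbar]
    simp only [pconj, Matrix.mul_assoc]
  have hshift : ∀ pl q s, s ∈ 𝒮 → Ebar pl (q + (s + pl)) = Ebar pl q := by
    intro pl q s hs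
    have e1 : pconj (q + (s + pl)) H = pconj pl (pconj q H) := by
      rw [show q + (s + pl) = pl + q + s by abel, pconj_add, hfix s hs, pconj_add]
    rw [hE, hE, e1, pconj_self]
    congr 2
    abel
  refine ⟨fun pl => ⟨?_, ?_⟩, ?_⟩
  · rw [hΓ']
    exact (hΓne pl).image _
  · intro γ' hγ'
    rw [hΓ', Finset.mem_image] at hγ'
    obtain ⟨γ, hγ, rfl⟩ := hγ'
    have h := concat_U_right γ (ζ (γ.last + pl)) (ζ (γ.last + pl)).T
    have h2 := hζend _ (hmem pl γ hγ)
    rw [PPath.last] at h2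
    rw [PPath.last, concat_T, h, h2, add_comm γ.last pl, add_assoc, lab_add_self, add_zero]
  · intro pl γ' hγ' t ht
    have hγ'0 := hγ'
    rw [hΓ', Finset.mem_image] at hγ'
    obtain ⟨γ, hγ, rfl⟩ := hγ'
    rw [concat_T] at ht
    by_cases hlt : t < γ.T
    · rw [concat_U_left _ _ (by omega), concat_U_left _ _ (by omega)]
      have hcard : (Γ' pl).card = (Γ pl).card := by
        rw [hΓ']; exact Finset.card_image_of_injOn (inj pl)
      have hcard2 : ((Γ' pl).filter (fun γ'' => γ''.hasEdge (γ.U t, γ.U (t + 1)))).card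
          = ((Γ pl).filter (fun γ' => γ'.hasEdge (γ.U t, γ.U (t + 1)))).card := by
        rw [hΓ', Finset.filter_image, Finset.card_image_of_injOn]
        · congr 1
          refine Finset.filter_congr fun γ₁ h₁ => ?_
          rw [concat_hasEdge]
          refine ⟨fun h => h.resolve_right ?_, Or.inl⟩
          rintro ⟨k, hk, he⟩
          exact hdisjoint pl γ₁ h₁ γ hγ k hk t hlt he
        · exact (inj pl).mono (by
            intro x hx
            exact (Finset.mem_filter.mp hx).1)
      rw [hcard, hcard2]
      linarith [hfree pl γ hγ t hlt]
    · obtain ⟨k, rfl⟩ := Nat.exists_eq_add_of_le (not_lt.mp hlt)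
      have hb : Ebar pl ((γ.concat (ζ (γ.last + pl))).U (γ.T + k)) ≤ w := by
        rw [concat_U_right]
        have h1 := hζbar _ (hmem pl γ hγ) k (by omega) pl
        obtain ⟨s, hs, he⟩ := hΓend pl γ hγ
        have h2 := hshift pl ((ζ (γ.last + pl)).U k) s hs
        rw [← he] at h2
        rwa [h2]
      have hlog : ∀ e, Real.log ((((Γ' pl).filter (fun γ'' => γ''.hasEdge e)).card : ℝ)
            / ((Γ' pl).card : ℝ)) ≤ 0 := by
        intro e
        apply Real.log_nonpos (by positivity)
        apply div_le_one_of_le₀ _ (by positivity)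
        exact_mod_cast Finset.card_filter_le _ _
      have := mul_nonpos_of_nonneg_of_nonpos (inv_pos.mpr hβ).le (hlog
        ((γ.concat (ζ (γ.last + pl))).U (γ.T + k), (γ.concat (ζ (γ.last + pl))).U (γ.T + k + 1)))
      linarith
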